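/- With the notation of the context, write τ := τ^E_{m,n}, τ_+ := τ^E_{m, n+e_l−e_{l'}} and τ_− := τ^E_{m, n−e_l+e_{l'}} for indices 1 ≤ l ≠ l' ≤ p with n_l ≥ 1 and n_{l'} ≥ 1. Then the following two bilinear identities hold as identities of functions of all parameters: (1) τ · ∂²τ/∂t_1^{(l)}∂t_1^{(l')} − (∂τ/∂t_1^{(l)})·(∂τ/∂t_1^{(l')}) = τ_+ · τ_−; (2) τ · ∂²τ/∂t_2^{(l)}∂t_1^{(l')} − (∂τ/∂t_2^{(l)})·(∂τ/∂t_1^{(l')}) = τ_− · ∂τ_+/∂t_1^{(l)} − τ_+ · ∂τ_−/∂t_1^{(l)}. -/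

import Mathlib

open MeasureTheory Finset

/-- Partial sum `M_k = Σ_{j<k} m_j` of the block sizes. -/
def Msum {q : ℕ} (m : Fin q → ℕ) (k : ℕ) : ℕ :=
  ∑ j ∈ Finset.univ.filter (fun j : Fin q => (j : ℕ) < k), m j

theorem Msum_add_lt {q : ℕ} (m : Fin q → ℕ) (r : Fin q) (i : Fin (m r)) :
    Msum m (r : ℕ) + (i : ℕ) < ∑ j, m j := by
  have h2 : m r ≤ ∑ j ∈ Finset.univ.filter (fun j : Fin q => ¬ (j : ℕ) < (r : ℕ)), m j :=
    Finset.single_le_sum (fun j _ => Nat.zero_le (m j)) (by simp)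
  have h3 : Msum m (r : ℕ) +
      ∑ j ∈ Finset.univ.filter (fun j : Fin q => ¬ (j : ℕ) < (r : ℕ)), m j = ∑ j, m j :=
    Finset.sum_filter_add_sum_filter_not _ _ _
  have h4 := i.isLt
  omega

/-- The index `M_{r−1} + i` of the `i`-th element of the `r`-th block (`0`-based). -/
def blkIdx {q : ℕ} (m : Fin q → ℕ) (r : Fin q) (i : Fin (m r)) : Fin (∑ j, m j) :=
  ⟨Msum m (r : ℕ) + (i : ℕ), Msum_add_lt m r i⟩

theorem Msum_block_le {q : ℕ} (m : Fin q → ℕ) {u u' : Fin q} (h : u < u') :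
    Msum m (u : ℕ) + m u ≤ Msum m (u' : ℕ) := by
  have hsub : insert u (Finset.univ.filter (fun j : Fin q => (j : ℕ) < (u : ℕ)))
      ⊆ Finset.univ.filter (fun j : Fin q => (j : ℕ) < (u' : ℕ)) := by
    intro j hj
    simp only [Finset.mem_insert, Finset.mem_filter, Finset.mem_univ, true_and] at hj ⊢
    have huu' : (u : ℕ) < (u' : ℕ) := h
    rcases hj with rfl | hj
    · exact huu'
    · omega
  have hle := Finset.sum_le_sum_of_subset (f := m) hsub
  rw [Finset.sum_insert (by simp)] at hle
  unfold Msum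
  omega

theorem blkIdx_injective {q : ℕ} (m : Fin q → ℕ) :
    Function.Injective (fun x : Σ r : Fin q, Fin (m r) => blkIdx m x.1 x.2) := by
  rintro ⟨r, i⟩ ⟨r', i'⟩ h
  have hval : Msum m (r : ℕ) + (i : ℕ) = Msum m (r' : ℕ) + (i' : ℕ) := congrArg Fin.val h
  rcases lt_trichotomy r r' with hlt | heq | hgt
  · exact absurd hval (by have h1 := Msum_block_le m hlt; have h2 := i.isLt; omega)
  · subst heq
    have : i = i' := Fin.ext (by omega)
    rw [this]
  · exact absurd hval (by have h1 := Msum_block_le m hgt; have h2 := i'.isLt; omega)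

/-- The canonical (order-preserving) equivalence between `Σ r, Fin (m r)` and `Fin (Σ m)`,
sending `(r, i)` to `M_{r−1} + i`. -/
noncomputable def blkEquiv {q : ℕ} (m : Fin q → ℕ) : (Σ r : Fin q, Fin (m r)) ≃ Fin (∑ j, m j) :=
  Equiv.ofBijective (fun x => blkIdx m x.1 x.2)
    ((Fintype.bijective_iff_injective_and_card _).mpr
      ⟨blkIdx_injective m, by simp [Fintype.card_sigma]⟩)

/-- The deformed tau function `τ^E_{m,n}(t,s;α,β;a,b)`: the determinant of the `N×N` moment
matrix composed of `p·q` blocks, the `(k,l)` block of size `m_k × n_l` having entries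
`∫_E x^{i+j} exp((a_k+b_l)x + (α_k+β_l)x² − Σ_{ν≥1} s_ν^{(k)} x^ν + Σ_{ν≥1} t_ν^{(l)} x^ν − x²/2) dx`
(defined to be `0` when the total block sizes do not match). -/
noncomputable def tauGen {q p : ℕ} (m : Fin q → ℕ) (n : Fin p → ℕ) (E : Set ℝ)
    (a : Fin q → ℝ) (b : Fin p → ℝ) (al : Fin q → ℝ) (be : Fin p → ℝ)
    (s : Fin q → ℕ → ℝ) (t : Fin p → ℕ → ℝ) : ℝ :=
  if h : ∑ l, n l = ∑ k, m k then
    Matrix.det (Matrix.of fun ri cj : Fin (∑ k, m k) =>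
      ∫ x in E,
        x ^ (((((blkEquiv m).symm ri).2 : ℕ)) + ((((blkEquiv n).symm (finCongr h.symm cj)).2 : ℕ))) *
          Real.exp ((a ((blkEquiv m).symm ri).1 + b ((blkEquiv n).symm (finCongr h.symm cj)).1) * x
            + (al ((blkEquiv m).symm ri).1 + be ((blkEquiv n).symm (finCongr h.symm cj)).1) * x ^ 2
            - (∑ᶠ ν ∈ Set.Ici (1 : ℕ), s ((blkEquiv m).symm ri).1 ν * x ^ ν)
            + (∑ᶠ ν ∈ Set.Ici (1 : ℕ), t ((blkEquiv n).symm (finCongr h.symm cj)).1 ν * x ^ ν)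
            - x ^ 2 / 2))
  else 0

/-- The set `E = ⋃_{i=1}^r [c_{2i−1}, c_{2i}]`. -/
def Eset {r : ℕ} (c : Fin (2 * r) → ℝ) : Set ℝ :=
  ⋃ i : Fin r, Set.Icc (c ⟨2 * (i : ℕ), by have := i.isLt; omega⟩)
    (c ⟨2 * (i : ℕ) + 1, by have := i.isLt; omega⟩)

/-- The space of time parameters `(s^{(1)},…,s^{(q)}; t^{(1)},…,t^{(p)})`. -/
abbrev TS (q p : ℕ) := (Fin q → ℕ → ℝ) × (Fin p → ℕ → ℝ)

/-- Partial derivative `∂/∂s_ν^{(k)}` of a function of the time parameters. -/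
noncomputable def dSts {q p : ℕ} (k : Fin q) (ν : ℕ) (f : TS q p → ℝ) : TS q p → ℝ :=
  fun st => deriv (fun h => f (Function.update st.1 k (Function.update (st.1 k) ν h), st.2))
    (st.1 k ν)

/-- Partial derivative `∂/∂t_ν^{(l)}` of a function of the time parameters. -/
noncomputable def dTts {q p : ℕ} (l : Fin p) (ν : ℕ) (f : TS q p → ℝ) : TS q p → ℝ :=
  fun st => deriv (fun h => f (st.1, Function.update st.2 l (Function.update (st.2 l) ν h)))
    (st.2 l ν)

/-- The tau function `τ^E_{m,n}` as a function of the time variables, with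
`E = ⋃_{i=1}^r [c_{2i−1}, c_{2i}]` and all other parameters fixed. -/
noncomputable def TT {q p r : ℕ} (m : Fin q → ℕ) (n : Fin p → ℕ) (c : Fin (2 * r) → ℝ)
    (a : Fin q → ℝ) (b : Fin p → ℝ) (al : Fin q → ℝ) (be : Fin p → ℝ) : TS q p → ℝ :=
  fun st => tauGen m n (Eset c) a b al be st.1 st.2

section Algebra

open Matrix in
/-- The three-term Plücker relation between determinants that differ in the columns `i` and `j`. -/
theorem det_updateCol_plucker {ι R : Type*} [Fintype ι] [DecidableEq ι] [CommRing R]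
    (A : Matrix ι ι R) {i j : ι} (hij : i ≠ j) (a b c d : ι → R) :
    ((A.updateCol i a).updateCol j b).det * ((A.updateCol i c).updateCol j d).det
      - ((A.updateCol i c).updateCol j b).det * ((A.updateCol i a).updateCol j d).det
      = ((A.updateCol i a).updateCol j c).det * ((A.updateCol i b).updateCol j d).det := by
  set B := (A.updateCol i c).updateCol j d with hB
  set C := A.updateCol i a with hC
  have key : cramer C (B.det • b) j = ∑ k, cramer B b k * cramer C (B.col k) j := by
    rw [← mulVec_cramer, mulVec_eq_sum, map_sum, Finset.sum_apply]
    refine Finset.sum_congr rfl fun k _ => ?_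
    simp [Matrix.col]
  rw [Finset.sum_eq_add i j hij] at key
  · rw [map_smul, Pi.smul_apply, smul_eq_mul] at key
    simp only [cramer_apply] at key
    have h1 : B.col i = c := by ext x; simp [hB, Matrix.col, hij]
    have h2 : B.col j = d := by ext x; simp [hB, Matrix.col]
    have h3 : B.updateCol i b = (A.updateCol i b).updateCol j d := by
      ext x y; simp only [hB, updateCol_apply]; split_ifs <;> simp_all
    have h4 : B.updateCol j b = (A.updateCol i c).updateCol j b := by
      ext x y; simp only [hB, updateCol_apply]; split_ifs <;> simp_all
    rw [h1, h2, h3, h4] at key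
    linear_combination key
  · intro k _ hk
    have : (C.updateCol j (B.col k)).det = 0 := by
      refine det_zero_of_column_eq hk.2 fun x => ?_
      simp [hC, hB, Matrix.col, hk.1, hk.2]
    rw [cramer_apply C, this, mul_zero]
  · simp
  · simp

/-- Two strictly increasing enumerations whose values differ by one exchange are related by a
permutation whose sign is determined by the two exchanged positions. -/
theorem exists_perm_of_exchange {α : Type*} [LinearOrder α] {N : ℕ} {L K : Fin N → α}
    (hL : StrictMono L) (hK : StrictMono K) (j₀ j₁ : Fin N)
    (hrange : Set.range K \ {K j₁} = Set.range L \ {L j₀}) :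
    ∃ σ : Equiv.Perm (Fin N), K ∘ σ = Function.update L j₀ (K j₁) ∧
      Equiv.Perm.sign σ = (-1) ^ ((j₀ : ℕ) + (j₁ : ℕ)) := by
  obtain _ | M := N
  · exact j₀.elim0
  have hr {F : Fin (M + 1) → α} (hF : StrictMono F) (j : Fin (M + 1)) :
      Set.range (F ∘ j.succAbove) = Set.range F \ {F j} := by
    rw [Set.range_comp, Fin.range_succAbove, Set.image_compl_eq_range_sdiff_image hF.injective,
      Set.image_singleton]
  have heq : K ∘ j₁.succAbove = L ∘ j₀.succAbove :=
    (StrictMono.range_inj (hK.comp (Fin.strictMono_succAbove j₁))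
      (hL.comp (Fin.strictMono_succAbove j₀))).1 (by rw [hr hK, hr hL, hrange])
  refine ⟨(Fin.cycleRange j₁)⁻¹ * Fin.cycleRange j₀, ?_, ?_⟩
  · funext x
    by_cases hx : x = j₀
    · subst hx
      simp [Equiv.Perm.inv_def]
    · obtain ⟨y, rfl⟩ := Fin.exists_succAbove_eq hx
      have h := congrFun heq y
      simp only [Function.comp_apply] at h
      simp [Equiv.Perm.inv_def, h]
  · rw [map_mul, map_inv, Fin.sign_cycleRange, Fin.sign_cycleRange, ← inv_pow, pow_add, mul_comm]
    simp

end Algebra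

section ColumnDeterminant

variable {N p q : ℕ}

/-- The determinant whose columns are picked by the labels `k` from a family of columns. -/
noncomputable def colDet (M : Fin N → Fin p × ℕ → TS q p → ℝ) (k : Fin N → Fin p × ℕ)
    (st : TS q p) : ℝ :=
  Matrix.det (Matrix.of fun i j => M i (k j) st)

theorem colDet_update (M : Fin N → Fin p × ℕ → TS q p → ℝ) (k : Fin N → Fin p × ℕ)
    (st : TS q p) (c : Fin N) (y : Fin p × ℕ) :
    colDet M (Function.update k c y) st =
      ((Matrix.of fun i j => M i (k j) st).updateCol c fun i => M i y st).det := by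
  unfold colDet
  congr 1
  ext i j
  by_cases h : j = c
  · subst h; simp
  · simp [h]

theorem colDet_comp_perm (M : Fin N → Fin p × ℕ → TS q p → ℝ) (k : Fin N → Fin p × ℕ)
    (σ : Equiv.Perm (Fin N)) (st : TS q p) :
    colDet M (k ∘ σ) st = (Equiv.Perm.sign σ : ℤ) * colDet M k st :=
  Matrix.det_permute' σ (Matrix.of fun i j => M i (k j) st)

theorem colDet_plucker (M : Fin N → Fin p × ℕ → TS q p → ℝ) (k : Fin N → Fin p × ℕ)
    {i j : Fin N} (hij : i ≠ j) (c d : Fin p × ℕ) (st : TS q p) :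
    colDet M k st * colDet M (Function.update (Function.update k i c) j d) st
      - colDet M (Function.update k i c) st * colDet M (Function.update k j d) st
      = colDet M (Function.update k j c) st *
        colDet M (Function.update (Function.update k i (k j)) j d) st := by
  have h := det_updateCol_plucker (Matrix.of fun x y => M x (k y) st) hij
    (fun x => M x (k i) st) (fun x => M x (k j) st) (fun x => M x c st) (fun x => M x d st)
  have e (u v : Fin p × ℕ) : (((Matrix.of fun x y => M x (k y) st).updateCol i
      fun x => M x u st).updateCol j fun x => M x v st).det
      = colDet M (Function.update (Function.update k i u) j v) st := by
    rw [colDet_update]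
    congr 2
    ext x y
    by_cases hy : y = i
    · subst hy; simp
    · simp [hy]
  simp only [e, Function.update_eq_self] at h
  have e2 : Function.update (Function.update k i c) j (k j) = Function.update k i c := by
    conv_lhs => rw [← Function.update_of_ne hij.symm c k, Function.update_eq_self]
  rw [e2] at h
  exact h

/-- The point `st` with the coordinate `t_ν^{(l)}` replaced by `h`. -/
def setTime (st : TS q p) (l : Fin p) (ν : ℕ) (h : ℝ) : TS q p :=
  (st.1, Function.update st.2 l (Function.update (st.2 l) ν h))

/-- Finitely many nonzero time variables. -/
def FiniteTimes (st : TS q p) : Prop :=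
  (∀ i, (Function.support (st.1 i)).Finite) ∧ ∀ i, (Function.support (st.2 i)).Finite

theorem FiniteTimes.setTime {st : TS q p} (hst : FiniteTimes st) (l : Fin p) (ν : ℕ) (h : ℝ) :
    FiniteTimes (setTime st l ν h) := by
  refine ⟨hst.1, fun i => ?_⟩
  by_cases hi : i = l
  · subst hi
    refine ((hst.2 i).insert ν).subset fun x hx => ?_
    by_cases hxν : x = ν
    · exact Or.inl hxν
    · simp [_root_.setTime, hxν] at hx
      exact Or.inr hx
  · simpa [_root_.setTime, hi] using hst.2 i

/-- `∂/∂t_ν^{(l)}` shifts the columns of the `l`-th block by `ν`. -/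
def ShiftsColumns (M : Fin N → Fin p × ℕ → TS q p → ℝ) : Prop :=
  ∀ st, FiniteTimes st → ∀ (l : Fin p) (ν : ℕ), 1 ≤ ν → ∀ i y,
    HasDerivAt (fun h => M i y (setTime st l ν h))
      (if y.1 = l then M i (y.1, y.2 + ν) st else 0) (st.2 l ν)

theorem hasDerivAt_det {ι : Type*} [Fintype ι] [DecidableEq ι] {A : ℝ → Matrix ι ι ℝ}
    {A' : Matrix ι ι ℝ} {x : ℝ} (hA : ∀ i j, HasDerivAt (fun h => A h i j) (A' i j) x) :
    HasDerivAt (fun h => (A h).det) (∑ c, ((A x).updateCol c fun i => A' i c).det) x := by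
  have h1 : HasDerivAt (fun h => ∑ σ : Equiv.Perm ι,
      ((Equiv.Perm.sign σ : ℤ) : ℝ) * ∏ i, A h (σ i) i)
      (∑ σ : Equiv.Perm ι, ((Equiv.Perm.sign σ : ℤ) : ℝ) *
        ∑ c, (∏ i ∈ Finset.univ.erase c, A x (σ i) i) • A' (σ c) c) x :=
    HasDerivAt.fun_sum fun σ _ =>
      (HasDerivAt.fun_finsetProd fun i _ => hA (σ i) i).const_mul _
  convert h1 using 1
  · funext h
    exact Matrix.det_apply' _
  · simp_rw [Matrix.det_apply', Finset.mul_sum]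
    rw [Finset.sum_comm]
    refine Finset.sum_congr rfl fun σ _ => Finset.sum_congr rfl fun c _ => ?_
    rw [← Finset.prod_erase_mul _ _ (Finset.mem_univ c), smul_eq_mul]
    congr 2
    · refine Finset.prod_congr rfl fun i hi => ?_
      simp [Finset.ne_of_mem_erase hi]
    · simp

theorem dTts_colDet {M : Fin N → Fin p × ℕ → TS q p → ℝ} (hM : ShiftsColumns M)
    (k : Fin N → Fin p × ℕ) {st : TS q p} (hst : FiniteTimes st) (l : Fin p) {ν : ℕ}
    (hν : 1 ≤ ν) (S : Finset (Fin N)) (hS : ∀ c ∈ S, (k c).1 = l)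
    (hcol : ∀ c, (k c).1 = l → c ∉ S → ∃ c', c' ≠ c ∧ k c' = (l, (k c).2 + ν)) :
    dTts l ν (colDet M k) st =
      ∑ c ∈ S, colDet M (Function.update k c (l, (k c).2 + ν)) st := by
  have hself : setTime st l ν (st.2 l ν) = st := by simp [setTime]
  have h := hasDerivAt_det (A := fun h => Matrix.of fun i j => M i (k j) (setTime st l ν h))
    (A' := Matrix.of fun i j => if (k j).1 = l then M i ((k j).1, (k j).2 + ν) st else 0)
    (x := st.2 l ν) fun i j => hM st hst l ν hν i (k j)
  have h2 : dTts l ν (colDet M k) st = _ := h.deriv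
  rw [h2]
  symm
  simp only [hself]
  refine Finset.sum_subset_zero_on_sdiff (Finset.subset_univ S) (fun c hc => ?_) fun c hc => ?_
  · by_cases hl : (k c).1 = l
    · obtain ⟨c', hne, hc'⟩ := hcol c hl (by simpa using hc)
      refine Matrix.det_zero_of_column_eq hne fun i => ?_
      simp [hne, hl, hc']
    · refine Matrix.det_eq_zero_of_column_eq_zero c fun i => ?_
      simp [hl]
  · rw [colDet_update]
    simp [hS c hc]

theorem dTts_const_mul (l : Fin p) (ν : ℕ) (r : ℝ) (f : TS q p → ℝ) (st : TS q p) :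
    dTts l ν (fun x => r * f x) st = r * dTts l ν f st :=
  deriv_const_mul_field r

theorem dTts_congr {f g : TS q p → ℝ} (hfg : ∀ st, FiniteTimes st → f st = g st) {st : TS q p}
    (hst : FiniteTimes st) (l : Fin p) (ν : ℕ) : dTts l ν f st = dTts l ν g st := by
  unfold dTts
  congr 1
  funext h
  exact hfg _ (hst.setTime l ν h)

end ColumnDeterminant

section ShiftedBlocks

variable {N p q : ℕ} {M : Fin N → Fin p × ℕ → TS q p → ℝ} {k : Fin N → Fin p × ℕ}
  {st : TS q p} {l l' : Fin p}

theorem dTts_one_colDet_of_last (hM : ShiftsColumns M) (hk : Function.Injective k)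
    (hst : FiniteTimes st) {J : ℕ} (hl : ∀ x, (l, x) ∈ Set.range k ↔ x ≤ J) {c : Fin N}
    (hc : k c = (l, J)) :
    dTts l 1 (colDet M k) st = colDet M (Function.update k c (l, J + 1)) st := by
  rw [dTts_colDet hM k hst l le_rfl {c} (by simp [hc]), Finset.sum_singleton, hc]
  intro d hd hdc
  have h1 : k d = (l, (k d).2) := Prod.ext hd rfl
  have h2 : (k d).2 ≤ J := (hl _).1 ⟨d, h1⟩
  have h3 : (k d).2 ≠ J := fun h => hdc (by simpa using hk (h1.trans (by rw [h, hc])))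
  obtain ⟨e, he⟩ := (hl ((k d).2 + 1)).2 (by omega)
  exact ⟨e, by rintro rfl; simpa using congrArg Prod.snd he, he⟩

theorem dTts_colDet_of_empty (hM : ShiftsColumns M) (hst : FiniteTimes st)
    (hl : ∀ c, (k c).1 ≠ l) {ν : ℕ} (hν : 1 ≤ ν) : dTts l ν (colDet M k) st = 0 := by
  rw [dTts_colDet hM k hst l hν ∅ (by simp) fun c hc => absurd hc (hl c), Finset.sum_empty]

theorem dTts_two_colDet_of_single (hM : ShiftsColumns M) (hk : Function.Injective k)
    (hst : FiniteTimes st) (hl : ∀ x, (l, x) ∈ Set.range k ↔ x ≤ 0) {c : Fin N}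
    (hc : k c = (l, 0)) :
    dTts l 2 (colDet M k) st = colDet M (Function.update k c (l, 2)) st := by
  rw [dTts_colDet hM k hst l one_le_two {c} (by simp [hc]), Finset.sum_singleton, hc]
  · rfl
  intro d hd hdc
  have h1 : k d = (l, (k d).2) := Prod.ext hd rfl
  have h2 : (k d).2 = 0 := Nat.le_zero.1 ((hl _).1 ⟨d, h1⟩)
  exact absurd (hk (h1.trans (by rw [h2, hc]))) (by simpa using hdc)

theorem dTts_two_colDet_of_last (hM : ShiftsColumns M) (hk : Function.Injective k)
    (hst : FiniteTimes st) {J : ℕ} (hl : ∀ x, (l, x) ∈ Set.range k ↔ x ≤ J + 1) {c d : Fin N}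
    (hc : k c = (l, J + 1)) (hd : k d = (l, J)) :
    dTts l 2 (colDet M k) st = colDet M (Function.update k c (l, J + 3)) st
      + colDet M (Function.update k d (l, J + 2)) st := by
  have hcd : c ≠ d := by rintro rfl; simp [hc] at hd
  rw [dTts_colDet hM k hst l one_le_two {c, d} (by simp [hc, hd]), Finset.sum_pair hcd, hc, hd]
  · rfl
  intro e he hecd
  have h1 : k e = (l, (k e).2) := Prod.ext he rfl
  have h2 : (k e).2 ≤ J + 1 := (hl _).1 ⟨e, h1⟩
  have h3 : (k e).2 ≠ J + 1 := fun h => hecd (by simp [hk (h1.trans (by rw [h, hc]))])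
  have h4 : (k e).2 ≠ J := fun h => hecd (by simp [hk (h1.trans (by rw [h, hd]))])
  obtain ⟨f, hf⟩ := (hl ((k e).2 + 2)).2 (by omega)
  exact ⟨f, by rintro rfl; simpa using congrArg Prod.snd hf, hf⟩

theorem mem_range_update_iff {α β : Type*} [DecidableEq α] {f : α → β}
    (hf : Function.Injective f) (a : α) (b z : β) :
    z ∈ Set.range (Function.update f a b) ↔ z = b ∨ z ≠ f a ∧ z ∈ Set.range f := by
  constructor
  · rintro ⟨x, rfl⟩
    by_cases hx : x = a
    · subst hx; simp
    · simp [hx, hf.ne hx]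
  · rintro (rfl | ⟨hne, x, rfl⟩)
    · exact ⟨a, by simp⟩
    · exact ⟨x, Function.update_of_ne (fun h => hne (by rw [h])) _ _⟩

theorem injective_update {α β : Type*} [DecidableEq α] {f : α → β}
    (hf : Function.Injective f) (a : α) {b : β} (hb : b ∉ Set.range f) :
    Function.Injective (Function.update f a b) := by
  intro x y hxy
  by_cases hx : x = a <;> by_cases hy : y = a
  · rw [hx, hy]
  · subst hx; simp [hy] at hxy; exact absurd ⟨y, hxy.symm⟩ hb
  · subst hy; simp [hx] at hxy; exact absurd ⟨x, hxy⟩ hb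
  · simp [hx, hy] at hxy; exact hf hxy

theorem update_update_eq_comp_swap {α β : Type*} [DecidableEq α] {f : α → β} {i j : α}
    (hij : i ≠ j) (b : β) :
    Function.update (Function.update f i (f j)) j b = Function.update f i b ∘ Equiv.swap i j := by
  funext x
  by_cases hxi : x = i
  · subst hxi; simp [hij, hij.symm]
  · by_cases hxj : x = j
    · subst hxj; simp
    · simp [hxi, hxj, Equiv.swap_apply_of_ne_of_ne]

variable {J J' : ℕ} {i j : Fin N}

theorem colDet_hirota_one (hM : ShiftsColumns M) (hk : Function.Injective k)
    (hst : FiniteTimes st) (hll : l ≠ l') (hl : ∀ x, (l, x) ∈ Set.range k ↔ x ≤ J)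
    (hl' : ∀ x, (l', x) ∈ Set.range k ↔ x ≤ J') (hi : k i = (l, J)) (hj : k j = (l', J')) :
    colDet M k st * dTts l 1 (dTts l' 1 (colDet M k)) st
      - dTts l 1 (colDet M k) st * dTts l' 1 (colDet M k) st
      = -(colDet M (Function.update k j (l, J + 1)) st *
          colDet M (Function.update k i (l', J' + 1)) st) := by
  have hij : i ≠ j := by rintro rfl; simp_all
  have hnl' : (l', J' + 1) ∉ Set.range k := by simp [-Set.mem_range, hl']
  have h2 : dTts l 1 (dTts l' 1 (colDet M k)) st =
      colDet M (Function.update (Function.update k i (l, J + 1)) j (l', J' + 1)) st := by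
    rw [dTts_congr (fun s hs => dTts_one_colDet_of_last hM hk hs hl' hj) hst,
      dTts_one_colDet_of_last hM (injective_update hk j hnl') hst (J := J) (c := i) ?_
        (by simp [hij, hi]), Function.update_comm hij]
    intro x
    rw [mem_range_update_iff hk, hl, hj]
    simp [hll]
  have hpl := colDet_plucker M k hij (l, J + 1) (l', J' + 1) st
  rw [update_update_eq_comp_swap hij, colDet_comp_perm, Equiv.Perm.sign_swap hij] at hpl
  rw [h2, dTts_one_colDet_of_last hM hk hst hl hi, dTts_one_colDet_of_last hM hk hst hl' hj]
  push_cast at hpl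
  linear_combination hpl

theorem colDet_hirota_two (hM : ShiftsColumns M) (hk : Function.Injective k)
    (hst : FiniteTimes st) (hll : l ≠ l') (hl : ∀ x, (l, x) ∈ Set.range k ↔ x ≤ J)
    (hl' : ∀ x, (l', x) ∈ Set.range k ↔ x ≤ J') (hi : k i = (l, J)) (hj : k j = (l', J')) :
    colDet M k st * dTts l 2 (dTts l' 1 (colDet M k)) st
      - dTts l 2 (colDet M k) st * dTts l' 1 (colDet M k) st
      = -(colDet M (Function.update k i (l', J' + 1)) st *
            dTts l 1 (colDet M (Function.update k j (l, J + 1))) st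
          - colDet M (Function.update k j (l, J + 1)) st *
            dTts l 1 (colDet M (Function.update k i (l', J' + 1))) st) := by
  have hij : i ≠ j := by rintro rfl; simp_all
  have hnl : (l, J + 1) ∉ Set.range k := by simp [-Set.mem_range, hl]
  have hnl' : (l', J' + 1) ∉ Set.range k := by simp [-Set.mem_range, hl']
  have hkj := injective_update hk j hnl'
  have hblock : ∀ x, (l, x) ∈ Set.range (Function.update k j (l', J' + 1)) ↔ x ≤ J := by
    intro x
    rw [mem_range_update_iff hk, hl, hj]
    simp [hll]
  have hplus : dTts l 1 (colDet M (Function.update k j (l, J + 1))) st =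
      colDet M (Function.update k j (l, J + 2)) st := by
    rw [dTts_one_colDet_of_last hM (injective_update hk j hnl) hst (J := J + 1) (c := j) ?_
      (by simp), Function.update_idem]
    intro x
    rw [mem_range_update_iff hk, hl, hj]
    simp [hll]
    omega
  have hpl := colDet_plucker M k hij (l, J + 2) (l', J' + 1) st
  rw [update_update_eq_comp_swap hij, colDet_comp_perm, Equiv.Perm.sign_swap hij] at hpl
  push_cast at hpl
  rw [dTts_congr (fun s hs => dTts_one_colDet_of_last hM hk hs hl' hj) hst,
    dTts_one_colDet_of_last hM hk hst hl' hj, hplus]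
  obtain _ | J := J
  · rw [dTts_two_colDet_of_single hM hkj hst hblock (c := i) (by simp [hij, hi]),
      dTts_two_colDet_of_single hM hk hst hl hi, Function.update_comm hij.symm]
    rw [dTts_colDet_of_empty hM hst ?_ le_rfl]
    · simp only [Nat.zero_add] at hpl ⊢
      linear_combination hpl
    · intro c hc
      by_cases hci : c = i
      · subst hci
        simp at hc
        exact hll hc.symm
      · rw [Function.update_of_ne hci] at hc
        have h1 : k c = (l, (k c).2) := Prod.ext hc rfl
        have h2 : (k c).2 = 0 := Nat.le_zero.1 ((hl _).1 ⟨c, h1⟩)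
        exact hci (hk (h1.trans (by rw [h2, hi])))
  · obtain ⟨d, hd⟩ := (hl J).2 (by omega)
    have hdi : d ≠ i := by rintro rfl; simp [hd] at hi
    have hdj : d ≠ j := by rintro rfl; simp_all
    have hminus : dTts l 1 (colDet M (Function.update k i (l', J' + 1))) st =
        colDet M (Function.update (Function.update k i (l', J' + 1)) d (l, J + 1)) st := by
      rw [dTts_one_colDet_of_last hM (injective_update hk i hnl') hst (J := J) (c := d) ?_
        (by simp [hdi, hd])]
      intro x
      rw [mem_range_update_iff hk, hl, hi]
      simp [hll]
      omega
    rw [dTts_two_colDet_of_last hM hkj hst hblock (c := i) (d := d) (by simp [hij, hi])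
        (by simp [hdj, hd]), dTts_two_colDet_of_last hM hk hst hl hi hd,
      Function.update_comm hij.symm, Function.update_comm hdj.symm, hminus]
    have hpl2 := colDet_plucker M k hdj (l, J + 2) (l', J' + 1) st
    have hrot : Function.update (Function.update k d (k j)) j (l', J' + 1)
        = Function.update (Function.update k i (l', J' + 1)) d (l, J + 1) ∘
          (Equiv.swap d i * Equiv.swap d j) := by
      funext x
      by_cases hxd : x = d
      · subst hxd
        simp [hdj, hdj.symm, hij.symm, Equiv.swap_apply_of_ne_of_ne]
      · by_cases hxj : x = j
        · subst hxj; simp [hdi.symm]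
        · by_cases hxi : x = i
          · subst hxi; simp [hxj, hxd, hi, Equiv.swap_apply_of_ne_of_ne]
          · simp [hxi, hxj, hxd, Equiv.swap_apply_of_ne_of_ne]
    rw [hrot, colDet_comp_perm, Equiv.Perm.sign_mul, Equiv.Perm.sign_swap hdi,
      Equiv.Perm.sign_swap hdj] at hpl2
    push_cast at hpl2
    linear_combination hpl + hpl2

end ShiftedBlocks

section BlockLabels

variable {p : ℕ}

/-- The block and the position inside the block of a column index. -/
noncomputable def blkLabel (n : Fin p → ℕ) {N : ℕ} (h : ∑ l, n l = N) (c : Fin N) : Fin p × ℕ :=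
  (((blkEquiv n).symm (finCongr h.symm c)).1, ((blkEquiv n).symm (finCongr h.symm c)).2)

/-- The column index of the `j`-th element of the `l`-th block. -/
def blkPos (n : Fin p → ℕ) {N : ℕ} (h : ∑ l, n l = N) (l : Fin p) (j : ℕ) (hj : j < n l) :
    Fin N :=
  finCongr h (blkIdx n l ⟨j, hj⟩)

variable {n : Fin p → ℕ} {N : ℕ} (h : ∑ l, n l = N)

theorem blkPos_val (l : Fin p) (j : ℕ) (hj : j < n l) :
    (blkPos n h l j hj : ℕ) = Msum n l + j := rfl

theorem blkLabel_blkPos (l : Fin p) (j : ℕ) (hj : j < n l) :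
    blkLabel n h (blkPos n h l j hj) = (l, j) := by
  have : (blkEquiv n).symm (finCongr h.symm (blkPos n h l j hj)) = ⟨l, ⟨j, hj⟩⟩ :=
    (Equiv.symm_apply_eq _).2 rfl
  rw [blkLabel, this]

theorem exists_eq_blkPos (c : Fin N) : ∃ l j hj, c = blkPos n h l j hj := by
  subst h
  obtain ⟨⟨l, j⟩, rfl⟩ := (blkEquiv n).surjective c
  exact ⟨l, j, j.2, rfl⟩

theorem mem_range_blkLabel (x : Fin p × ℕ) : x ∈ Set.range (blkLabel n h) ↔ x.2 < n x.1 := by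
  constructor
  · rintro ⟨c, rfl⟩
    obtain ⟨l, j, hj, rfl⟩ := exists_eq_blkPos h c
    simpa [blkLabel_blkPos] using hj
  · intro hx
    exact ⟨_, blkLabel_blkPos h x.1 x.2 hx⟩

theorem strictMono_toLex_blkLabel : StrictMono fun c => toLex (blkLabel n h c) := by
  intro c d hcd
  obtain ⟨l, i, hi, rfl⟩ := exists_eq_blkPos h c
  obtain ⟨l', j, hj, rfl⟩ := exists_eq_blkPos h d
  have hlt : Msum n l + i < Msum n l' + j := hcd
  simp only [blkLabel_blkPos, Prod.Lex.toLex_lt_toLex]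
  rcases lt_trichotomy l l' with hl | rfl | hl
  · exact Or.inl hl
  · exact Or.inr ⟨rfl, by omega⟩
  · have := Msum_block_le n hl
    omega

theorem blkLabel_injective : Function.Injective (blkLabel n h) :=
  fun _ _ hcd => (strictMono_toLex_blkLabel h).injective (congrArg toLex hcd)

theorem Msum_transfer {l l' : Fin p} (hll : l ≠ l') (hl' : 1 ≤ n l') :
    Msum (Function.update (Function.update n l (n l + 1)) l' (n l' - 1)) l
      + (if l' < l then 1 else 0) = Msum n l := by
  unfold Msum
  have hδ : (if l' < l then 1 else 0) = ∑ x, if x = l' then if x < l then 1 else 0 else 0 := by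
    simp
  rw [Finset.sum_filter, Finset.sum_filter, hδ, ← Finset.sum_add_distrib]
  refine Finset.sum_congr rfl fun x _ => ?_
  by_cases hx : x = l'
  · subst hx
    by_cases hxl : x < l
    · simp [hxl, Nat.sub_add_cancel hl']
    · simp [hxl]
  · by_cases hxl : x = l
    · subst hxl; simp [hx]
    · simp [hx, hxl]

theorem sum_transfer {l l' : Fin p} (hll : l ≠ l') (hl' : 1 ≤ n l') :
    ∑ x, Function.update (Function.update n l (n l + 1)) l' (n l' - 1) x = ∑ x, n x := by
  have key : ∑ x, (Function.update (Function.update n l (n l + 1)) l' (n l' - 1) x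
      + if x = l' then 1 else 0) = ∑ x, (n x + if x = l then 1 else 0) := by
    refine Finset.sum_congr rfl fun x _ => ?_
    by_cases hx : x = l'
    · subst hx
      simp [hll.symm, Nat.sub_add_cancel hl']
    · by_cases hxl : x = l
      · subst hxl; simp [hx]
      · simp [hx, hxl]
  simpa [Finset.sum_add_distrib] using key

/-- Moving one element from block `l'` to block `l` permutes the columns with a definite sign. -/
theorem exists_perm_blkLabel_transfer {l l' : Fin p} (hll : l ≠ l') (hl' : 1 ≤ n l')
    (h' : ∑ x, Function.update (Function.update n l (n l + 1)) l' (n l' - 1) x = N) :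
    ∃ σ : Equiv.Perm (Fin N),
      blkLabel _ h' ∘ σ = Function.update (blkLabel n h)
        (blkPos n h l' (n l' - 1) (Nat.sub_lt hl' one_pos)) (l, n l) ∧
      Equiv.Perm.sign σ
        = (-1) ^ (Msum n l' + (n l' - 1) + (Msum n l + n l) + if l' < l then 1 else 0) := by
  set n' := Function.update (Function.update n l (n l + 1)) l' (n l' - 1) with hn'
  have hnl : n' l = n l + 1 := by simp [hn', hll]
  have hnl' : n' l' = n l' - 1 := by simp [hn']
  obtain ⟨σ, h1, h2⟩ := exists_perm_of_exchange (strictMono_toLex_blkLabel h)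
    (strictMono_toLex_blkLabel h') (blkPos n h l' (n l' - 1) (Nat.sub_lt hl' one_pos))
    (blkPos n' h' l (n l) (by omega)) (by
      have e {n : Fin p → ℕ} (h : ∑ x, n x = N) : Set.range (fun c => toLex (blkLabel n h c))
          = {x | (ofLex x).2 < n (ofLex x).1} := by
        ext x
        exact mem_range_blkLabel h (ofLex x)
      rw [e, e, blkLabel_blkPos, blkLabel_blkPos]
      ext ⟨x, y⟩
      change (y < n' x ∧ ¬ (x, y) = (l, n l)) ↔ (y < n x ∧ ¬ (x, y) = (l', n l' - 1))
      simp only [Prod.mk.injEq]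
      by_cases hx : x = l'
      · subst hx
        simp [hnl', hll.symm]
        omega
      · by_cases hxl : x = l
        · subst hxl
          simp [hnl, hx]
          omega
        · simp [hn', hx, hxl])
  refine ⟨σ, ?_, ?_⟩
  · funext x
    have := congrFun h1 x
    rw [blkLabel_blkPos] at this
    by_cases hx : x = blkPos n h l' (n l' - 1) (Nat.sub_lt hl' one_pos)
    · subst hx
      simpa using this
    · rw [Function.update_of_ne hx] at this ⊢
      exact toLex.injective this
  · rw [h2, blkPos_val, blkPos_val, neg_one_pow_congr]
    have := Msum_transfer (n := n) hll hl'
    rw [← hn'] at this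
    rw [← this]
    simp only [Nat.even_iff]
    split_ifs <;> omega

end BlockLabels

section Moments

theorem hasDerivAt_setIntegral_mul_exp {E : Set ℝ} (hE : IsCompact E) {g : ℝ → ℝ}
    (hg : Continuous g) (ν : ℕ) (h₀ : ℝ) :
    HasDerivAt (fun h => ∫ x in E, g x * Real.exp ((h - h₀) * x ^ ν))
      (∫ x in E, g x * x ^ ν) h₀ := by
  have hint {f : ℝ → ℝ} (hf : Continuous f) : IntegrableOn f E :=
    hf.continuousOn.integrableOn_compact hE
  have key := (hasDerivAt_integral_of_dominated_loc_of_deriv_le (μ := volume.restrict E)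
    (F := fun h x => g x * Real.exp ((h - h₀) * x ^ ν))
    (F' := fun h x => g x * (Real.exp ((h - h₀) * x ^ ν) * x ^ ν))
    (bound := fun x => |g x| * (Real.exp |x ^ ν| * |x ^ ν|)) (x₀ := h₀)
    (Metric.ball_mem_nhds h₀ one_pos)
    (Filter.Eventually.of_forall fun h => (hint (by fun_prop)).aestronglyMeasurable)
    (hint (by fun_prop)) (hint (by fun_prop)).aestronglyMeasurable
    (Filter.Eventually.of_forall fun x h hh => ?_) (hint (by fun_prop))
    (Filter.Eventually.of_forall fun x h hh => ?_)).2
  · simpa using key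
  · rw [Real.norm_eq_abs, abs_mul, abs_mul, Real.abs_exp]
    gcongr
    refine (le_abs_self _).trans ?_
    rw [abs_mul]
    rw [Metric.mem_ball, Real.dist_eq] at hh
    exact mul_le_of_le_one_left (abs_nonneg _) hh.le
  · have h1 : HasDerivAt (fun h => (h - h₀) * x ^ ν) (1 * x ^ ν) h :=
      ((hasDerivAt_id h).sub_const h₀).mul_const _
    simpa using h1.exp.const_mul (g x)

/-- The potential `Σ_{ν≥1} T_ν x^ν`. -/
noncomputable def timePotential (T : ℕ → ℝ) (x : ℝ) : ℝ :=
  ∑ᶠ ν ∈ Set.Ici (1 : ℕ), T ν * x ^ ν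

theorem finite_inter_support {T : ℕ → ℝ} (hT : (Function.support T).Finite) (x : ℝ) :
    (Set.Ici (1 : ℕ) ∩ Function.support fun ν => T ν * x ^ ν).Finite :=
  hT.subset fun _ hν h => hν.2 (by simp [Function.notMem_support.1 (not_not_intro h)])

theorem continuous_timePotential {T : ℕ → ℝ} (hT : (Function.support T).Finite) :
    Continuous (timePotential T) := by
  have : timePotential T = fun x => ∑ ν ∈ hT.toFinset with 1 ≤ ν, T ν * x ^ ν := by
    funext x
    refine finsum_mem_eq_sum_of_subset _ (fun ν hν => ?_) fun ν hν => ?_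
    · have h1 : T ν ≠ 0 := fun h => hν.2 (by simp [h])
      simpa [h1] using hν.1
    · simpa using (Finset.mem_filter.1 hν).2
  rw [this]
  fun_prop

theorem timePotential_update {T : ℕ → ℝ} (hT : (Function.support T).Finite) {ν : ℕ}
    (hν : 1 ≤ ν) (h x : ℝ) :
    timePotential (Function.update T ν h) x = timePotential T x + (h - T ν) * x ^ ν := by
  unfold timePotential
  have hsing : (Function.support (Pi.single ν (h - T ν) : ℕ → ℝ)).Finite :=
    (Set.finite_singleton ν).subset Pi.support_single_subset
  have h1 : ∑ᶠ i ∈ Set.Ici (1 : ℕ), (Pi.single ν (h - T ν) : ℕ → ℝ) i * x ^ i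
      = (h - T ν) * x ^ ν := by
    rw [finsum_mem_eq_sum_of_subset (t := {ν})]
    · simp
    · intro i hi
      by_contra hne
      exact hi.2 (by simp [show i ≠ ν by simpa using hne])
    · simpa using hν
  rw [← h1, ← finsum_mem_add_distrib' (finite_inter_support hT x) (finite_inter_support hsing x)]
  refine finsum_mem_congr rfl fun i _ => ?_
  by_cases hi : i = ν
  · subst hi; simp; ring
  · simp [hi]

variable {p q : ℕ}

/-- The entry of the moment matrix in the `i`-th row of the `k`-th block and the column
labelled `y`. -/
noncomputable def moment (E : Set ℝ) (a : Fin q → ℝ) (b : Fin p → ℝ) (al : Fin q → ℝ)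
    (be : Fin p → ℝ) (k : Fin q) (i : ℕ) (y : Fin p × ℕ) (st : TS q p) : ℝ :=
  ∫ x in E, x ^ (i + y.2) * Real.exp ((a k + b y.1) * x + (al k + be y.1) * x ^ 2
    - timePotential (st.1 k) x + timePotential (st.2 y.1) x - x ^ 2 / 2)

theorem hasDerivAt_moment {E : Set ℝ} (hE : IsCompact E) (a : Fin q → ℝ) (b : Fin p → ℝ)
    (al : Fin q → ℝ) (be : Fin p → ℝ) (k : Fin q) (i : ℕ) (y : Fin p × ℕ) {st : TS q p}
    (hst : FiniteTimes st) (l : Fin p) {ν : ℕ} (hν : 1 ≤ ν) :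
    HasDerivAt (fun h => moment E a b al be k i y (setTime st l ν h))
      (if y.1 = l then moment E a b al be k i (y.1, y.2 + ν) st else 0) (st.2 l ν) := by
  obtain ⟨l', j⟩ := y
  by_cases hl : l' = l
  · subst hl
    rw [if_pos rfl]
    have hs := continuous_timePotential (hst.1 k)
    have ht := continuous_timePotential (hst.2 l')
    have key := hasDerivAt_setIntegral_mul_exp hE
      (g := fun x => x ^ (i + j) * Real.exp ((a k + b l') * x + (al k + be l') * x ^ 2
        - timePotential (st.1 k) x + timePotential (st.2 l') x - x ^ 2 / 2))
      (by fun_prop) ν (st.2 l' ν)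
    convert key using 1
    · funext h
      refine integral_congr_ae (Filter.Eventually.of_forall fun x => ?_)
      simp only [setTime, Function.update_self, timePotential_update (hst.2 l') hν]
      rw [mul_assoc, ← Real.exp_add]
      ring_nf
    · refine integral_congr_ae (Filter.Eventually.of_forall fun x => ?_)
      simp only
      ring
  · simp only [if_neg hl]
    have hconst : (fun h => moment E a b al be k i (l', j) (setTime st l ν h))
        = fun _ => moment E a b al be k i (l', j) st := by
      funext h
      simp [moment, setTime, hl]
    rw [hconst]
    exact hasDerivAt_const _ _

theorem isCompact_Eset {r : ℕ} (c : Fin (2 * r) → ℝ) : IsCompact (Eset c) :=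
  isCompact_iUnion fun _ => isCompact_Icc

/-- The rows of the moment matrix as a family of columns labelled by block and position. -/
noncomputable def momentColumns (m : Fin q → ℕ) (E : Set ℝ) (a : Fin q → ℝ) (b : Fin p → ℝ)
    (al : Fin q → ℝ) (be : Fin p → ℝ) (i : Fin (∑ k, m k)) (y : Fin p × ℕ) (st : TS q p) : ℝ :=
  moment E a b al be ((blkEquiv m).symm i).1 ((blkEquiv m).symm i).2 y st

theorem shiftsColumns_momentColumns (m : Fin q → ℕ) {E : Set ℝ} (hE : IsCompact E)
    (a : Fin q → ℝ) (b : Fin p → ℝ) (al : Fin q → ℝ) (be : Fin p → ℝ) :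
    ShiftsColumns (momentColumns m E a b al be) :=
  fun _ hst l _ hν _ y => hasDerivAt_moment hE a b al be _ _ y hst l hν

theorem TT_eq_colDet {r : ℕ} (m : Fin q → ℕ) {n : Fin p → ℕ} (c : Fin (2 * r) → ℝ)
    (a : Fin q → ℝ) (b : Fin p → ℝ) (al : Fin q → ℝ) (be : Fin p → ℝ)
    (h : ∑ l, n l = ∑ k, m k) :
    TT m n c a b al be = colDet (momentColumns m (Eset c) a b al be) (blkLabel n h) := by
  funext st
  unfold TT tauGen
  rw [dif_pos h]
  rfl

theorem TT_transfer_eq_colDet {r : ℕ} (m : Fin q → ℕ) {n : Fin p → ℕ} (c : Fin (2 * r) → ℝ)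
    (a : Fin q → ℝ) (b : Fin p → ℝ) (al : Fin q → ℝ) (be : Fin p → ℝ)
    (h : ∑ l, n l = ∑ k, m k) {l l' : Fin p} (hll : l ≠ l') (hl' : 1 ≤ n l') :
    TT m (Function.update (Function.update n l (n l + 1)) l' (n l' - 1)) c a b al be =
      fun st => (-1) ^ (Msum n l' + (n l' - 1) + (Msum n l + n l) + if l' < l then 1 else 0) *
        colDet (momentColumns m (Eset c) a b al be)
          (Function.update (blkLabel n h)
            (blkPos n h l' (n l' - 1) (Nat.sub_lt hl' one_pos)) (l, n l)) st := by
  have h' := (sum_transfer hll hl').trans h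
  obtain ⟨σ, h1, h2⟩ := exists_perm_blkLabel_transfer h hll hl' h'
  funext st
  rw [TT_eq_colDet m c a b al be h', ← h1, colDet_comp_perm, h2]
  push_cast
  rw [← mul_assoc, ← mul_pow]
  simp

end Moments

/-- The Hirota-type bilinear identities (3.6) and (3.7) derived from the `(p+q)`-component KP
hierarchy: writing `τ = τ^E_{m,n}`, `τ_+ = τ^E_{m,n+e_l−e_{l'}}` and `τ_− = τ^E_{m,n−e_l+e_{l'}}`,
(1) `τ ∂²τ/∂t_1^{(l)}∂t_1^{(l')} − (∂τ/∂t_1^{(l)})(∂τ/∂t_1^{(l')}) = τ_+ τ_−`;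
(2) `τ ∂²τ/∂t_2^{(l)}∂t_1^{(l')} − (∂τ/∂t_2^{(l)})(∂τ/∂t_1^{(l')})
      = τ_− ∂τ_+/∂t_1^{(l)} − τ_+ ∂τ_−/∂t_1^{(l)}`,
as identities of functions of all the parameters. -/
theorem hirota_bilinear_identities (q p r : ℕ) (hq : 1 ≤ q) (hp : 1 ≤ p)
    (m : Fin q → ℕ) (n : Fin p → ℕ) (hm1 : ∀ i, 1 ≤ m i) (hn1 : ∀ i, 1 ≤ n i)
    (hsum : ∑ i, n i = ∑ i, m i)
    (a : Fin q → ℝ) (b : Fin p → ℝ) (al : Fin q → ℝ) (be : Fin p → ℝ)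
    (c : Fin (2 * r) → ℝ) (hc : StrictMono c)
    (l l' : Fin p) (hll : l ≠ l') (hl : 1 ≤ n l) (hl' : 1 ≤ n l')
    (st : TS q p) (hs : ∀ i, (Function.support (st.1 i)).Finite)
    (ht : ∀ i, (Function.support (st.2 i)).Finite) :
    (TT m n c a b al be st * dTts l 1 (dTts l' 1 (TT m n c a b al be)) st
        - dTts l 1 (TT m n c a b al be) st * dTts l' 1 (TT m n c a b al be) st
      = TT m (Function.update (Function.update n l (n l + 1)) l' (n l' - 1)) c a b al be st *
          TT m (Function.update (Function.update n l (n l - 1)) l' (n l' + 1)) c a b al be st) ∧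
    (TT m n c a b al be st * dTts l 2 (dTts l' 1 (TT m n c a b al be)) st
        - dTts l 2 (TT m n c a b al be) st * dTts l' 1 (TT m n c a b al be) st
      = TT m (Function.update (Function.update n l (n l - 1)) l' (n l' + 1)) c a b al be st *
          dTts l 1 (TT m (Function.update (Function.update n l (n l + 1)) l' (n l' - 1))
            c a b al be) st
        - TT m (Function.update (Function.update n l (n l + 1)) l' (n l' - 1)) c a b al be st *
          dTts l 1 (TT m (Function.update (Function.update n l (n l - 1)) l' (n l' + 1))
            c a b al be) st) := by

  have hst : FiniteTimes st := ⟨hs, ht⟩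
  have hM := shiftsColumns_momentColumns m (isCompact_Eset c) a b al be
  have hlast {x : Fin p} (hx : 1 ≤ n x) : n x - 1 < n x := Nat.sub_lt hx one_pos
  have hr {x : Fin p} (hx : 1 ≤ n x) (y : ℕ) :
      (x, y) ∈ Set.range (blkLabel n hsum) ↔ y ≤ n x - 1 := by
    rw [mem_range_blkLabel]
    change y < n x ↔ y ≤ n x - 1
    omega
  have h1 := colDet_hirota_one hM (blkLabel_injective hsum) hst hll (hr hl) (hr hl')
    (blkLabel_blkPos hsum l _ (hlast hl)) (blkLabel_blkPos hsum l' _ (hlast hl'))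
  have h2 := colDet_hirota_two hM (blkLabel_injective hsum) hst hll (hr hl) (hr hl')
    (blkLabel_blkPos hsum l _ (hlast hl)) (blkLabel_blkPos hsum l' _ (hlast hl'))
  rw [Nat.sub_add_cancel hl, Nat.sub_add_cancel hl'] at h1 h2
  have hsign : ((-1 : ℝ) ^ (Msum n l' + (n l' - 1) + (Msum n l + n l) + if l' < l then 1 else 0)) *
      (-1) ^ (Msum n l + (n l - 1) + (Msum n l' + n l') + if l < l' then 1 else 0) = -1 := by
    rw [← pow_add]
    refine Odd.neg_one_pow (Nat.odd_iff.2 ?_)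
    rcases lt_or_gt_of_ne hll with hlt | hlt <;> simp only [hlt, hlt.not_gt, if_true, if_false] <;>
      omega
  have hcomm : Function.update (Function.update n l (n l - 1)) l' (n l' + 1)
      = Function.update (Function.update n l' (n l' + 1)) l (n l - 1) :=
    Function.update_comm hll _ _ _
  rw [hcomm, TT_eq_colDet m c a b al be hsum,
    TT_transfer_eq_colDet m c a b al be hsum hll hl',
    TT_transfer_eq_colDet m c a b al be hsum hll.symm hl]
  simp only [dTts_const_mul]
  constructor
  · rw [h1, mul_mul_mul_comm, hsign]
    ring
  · rw [h2]
    linear_combination (colDet (momentColumns m (Eset c) a b al be)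
      (Function.update (blkLabel n hsum) (blkPos n hsum l' (n l' - 1) (hlast hl')) (l, n l)) st
      * dTts l 1 (colDet (momentColumns m (Eset c) a b al be)
        (Function.update (blkLabel n hsum) (blkPos n hsum l (n l - 1) (hlast hl)) (l', n l'))) st
      - colDet (momentColumns m (Eset c) a b al be)
        (Function.update (blkLabel n hsum) (blkPos n hsum l (n l - 1) (hlast hl)) (l', n l')) st
      * dTts l 1 (colDet (momentColumns m (Eset c) a b al be)
        (Function.update (blkLabel n hsum) (blkPos n hsum l' (n l' - 1) (hlast hl')) (l, n l))) st)
      * hsign
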